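/- arXiv:2401.05156 — 2 statements merged into one kernel-verified Lean document; each statement's English description precedes it below -/
import Mathlib

section
/- Assume (A1) and additionally that f is C². Let δ > 0 and define Φ_ε(x) := (n−1)ε/(f(x) + δ). Then there exists ε₀ > 0 such that for all ε ∈ (0, ε₀) and all x ∈ ℝ: −Φ_ε''(x)/((Φ_ε'(x))² + 1) + (n−1)/Φ_ε(x) − (1/ε) f(x) √((Φ_ε'(x))² + 1) ≥ 0; that is, the time-independent function Φ_ε is a supersolution of the scaled forced mean curvature flow equation u_t = u_xx/((u_x)² + 1) − (n−1)/u + (1/ε) f(x) √((u_x)² + 1). -/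
open Real Set Filter Topology

noncomputable section

/-- Assumption (A1): `f` is `C¹`, `ℤ`-periodic and positive; `g` is `C²`, `ℤ`-periodic
and positive. -/
def A1 (f g : ℝ → ℝ) : Prop :=
  ContDiff ℝ 1 f ∧ (∀ x, f (x + 1) = f x) ∧ (∀ x, 0 < f x) ∧
  ContDiff ℝ 2 g ∧ (∀ x, g (x + 1) = g x) ∧ (∀ x, 0 < g x)

/-- A continuous `1`-periodic real function is bounded. -/
theorem exists_abs_le_of_continuous_of_periodic {h : ℝ → ℝ} (hc : Continuous h)
    (hp : Function.Periodic h 1) : ∃ C : ℝ, 0 ≤ C ∧ ∀ x, |h x| ≤ C := by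
  obtain ⟨C, hC⟩ := (hp.isBounded_of_continuous one_ne_zero hc).exists_norm_le
  have hC' : ∀ x, |h x| ≤ C := fun x => hC (h x) (mem_range_self x)
  exact ⟨C, (abs_nonneg _).trans (hC' 0), hC'⟩

/-- The derivative of a periodic function is periodic. -/
theorem periodic_deriv {h : ℝ → ℝ} {c : ℝ} (hp : Function.Periodic h c) :
    Function.Periodic (deriv h) c := fun x => by
  rw [← deriv_comp_add_const, funext hp]

theorem sqrt_sq_add_one_le (p : ℝ) : √(p ^ 2 + 1) ≤ 1 + |p| := by
  rw [Real.sqrt_le_left (by positivity)]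
  nlinarith [sq_abs p, abs_nonneg p]

/-- under (A1) with `f` moreover `C²`, for any `δ > 0` the time-independent
function `Φ_ε(x) = (n−1)ε/(f(x) + δ)` is, for every sufficiently small `ε > 0`, a
supersolution of the scaled forced mean curvature flow equation:
`0 ≤ −Φ_ε''/((Φ_ε')² + 1) + (n−1)/Φ_ε − (1/ε) f √((Φ_ε')² + 1)`. -/
theorem phi_supersolution (n : ℕ) (hn : 2 ≤ n) (f g : ℝ → ℝ) (hA1 : A1 f g)
    (hf2 : ContDiff ℝ 2 f) (δ : ℝ) (hδ : 0 < δ) :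
    ∃ ε₀ : ℝ, 0 < ε₀ ∧ ∀ ε : ℝ, 0 < ε → ε < ε₀ →
      ∀ Φ : ℝ → ℝ, (∀ x : ℝ, Φ x = ((n : ℝ) - 1) * ε / (f x + δ)) →
        ∀ x : ℝ,
          0 ≤ -deriv (deriv Φ) x / ((deriv Φ x) ^ 2 + 1) + ((n : ℝ) - 1) / Φ x
            - (1 / ε) * f x * Real.sqrt ((deriv Φ x) ^ 2 + 1) := by
  obtain ⟨-, hper, hpos, -⟩ := hA1
  have hne : ∀ x, f x + δ ≠ 0 := fun x => (add_pos (hpos x) hδ).ne'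
  set h : ℝ → ℝ := fun x => (f x + δ)⁻¹ with hh
  have hsmooth : ContDiff ℝ 2 h := (hf2.add contDiff_const).inv hne
  have hhper : Function.Periodic h 1 := fun x => by simp only [hh, hper x]
  have hsmooth' : ContDiff ℝ 1 (deriv h) := hsmooth.deriv'
  obtain ⟨M, hM0, hM⟩ := exists_abs_le_of_continuous_of_periodic hf2.continuous hper
  obtain ⟨A, hA0, hA⟩ := exists_abs_le_of_continuous_of_periodic hsmooth'.continuous
    (periodic_deriv hhper)
  obtain ⟨B, hB0, hB⟩ := exists_abs_le_of_continuous_of_periodic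
    (hsmooth'.continuous_deriv le_rfl) (periodic_deriv (periodic_deriv hhper))
  have hn' : (2 : ℝ) ≤ n := by exact_mod_cast hn
  obtain ⟨c, hc⟩ : ∃ c : ℝ, c = (n : ℝ) - 1 := ⟨_, rfl⟩
  have hc0 : 0 < c := by linarith
  rw [← hc]
  have hK : 0 < M * (c * A) + c * B + 1 := by positivity
  refine ⟨min 1 (δ / (M * (c * A) + c * B + 1)), by positivity, ?_⟩
  intro ε hε hεlt Φ hΦ x
  have hε1 : ε < 1 := hεlt.trans_le (min_le_left _ _)
  have hεK : ε * (M * (c * A) + c * B + 1) < δ :=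
    (lt_div_iff₀ hK).1 (hεlt.trans_le (min_le_right _ _))
  have hΦh : Φ = fun y => c * ε * h y := by
    funext y
    rw [hΦ, div_eq_mul_inv]
  have hd : deriv Φ = fun y => c * ε * deriv h y := by
    funext y
    rw [hΦh, deriv_const_mul_field]
  have hdd : deriv (deriv Φ) x = c * ε * deriv (deriv h) x := by
    rw [hd, deriv_const_mul_field]
  have hp : |deriv Φ x| ≤ c * ε * A := by
    rw [hd, abs_mul, abs_of_pos (mul_pos hc0 hε)]
    gcongr
    exact hA x
  have hq : |deriv (deriv Φ) x| ≤ c * ε * B := by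
    rw [hdd, abs_mul, abs_of_pos (mul_pos hc0 hε)]
    gcongr
    exact hB x
  have hcurv : deriv (deriv Φ) x / ((deriv Φ x) ^ 2 + 1) ≤ c * B := by
    rw [div_le_iff₀ (by positivity)]
    have h1 : c * ε * B ≤ c * B := by
      nlinarith [mul_nonneg hc0.le hB0]
    have h2 : 0 ≤ c * B * (deriv Φ x) ^ 2 := by positivity
    linarith [le_abs_self (deriv (deriv Φ) x)]
  have hforce : f x * √((deriv Φ x) ^ 2 + 1) ≤ f x + M * (c * ε * A) := by
    calc f x * √((deriv Φ x) ^ 2 + 1) ≤ f x * (1 + |deriv Φ x|) :=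
          mul_le_mul_of_nonneg_left (sqrt_sq_add_one_le _) (hpos x).le
      _ = f x + f x * |deriv Φ x| := by ring
      _ ≤ f x + M * (c * ε * A) := by
          gcongr
          exact (le_abs_self _).trans (hM x)
  have hdiv : c / Φ x = (f x + δ) / ε := by
    have := hne x
    rw [hΦ]
    field_simp
  have hmain : c * B ≤ (f x + δ) / ε - 1 / ε * f x * √((deriv Φ x) ^ 2 + 1) := by
    rw [mul_assoc, one_div_mul_eq_div, ← sub_div, le_div_iff₀ hε]
    linarith
  rw [hdiv, neg_div]
  linarith
end
end

section
/- Assume (A1) and additionally that f'(x) ≥ 0 for all x ∈ [0,1/2]. Let u be a positive classical solution on ℝ × [0,T) and suppose u_x(x,t) ≥ 0 for all (x,t) ∈ (0,1/2) × (0,T). Then v := u_x satisfies the differential inequality v_t ≥ v_xx/((u_x)² + 1) + f(x) v v_x/√((u_x)² + 1) − 2 v (v_x)²/((u_x)² + 1)² at every point of (0,1/2) × (0,T). -/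
open Real Set Filter Topology

noncomputable section

/-- Partial derivative in the space variable `x`. -/
def pdx (u : ℝ → ℝ → ℝ) (x t : ℝ) : ℝ := deriv (fun y => u y t) x

/-- Second partial derivative in the space variable `x`. -/
def pdxx (u : ℝ → ℝ → ℝ) (x t : ℝ) : ℝ := deriv (fun y => pdx u y t) x

/-- Partial derivative in the time variable `t`. -/
def pdt (u : ℝ → ℝ → ℝ) (x t : ℝ) : ℝ := deriv (fun s => u x s) t

/-- A positive classical solution of the scaled problem on `ℝ × [0, T)`, where
`T : EReal` with `0 < T ≤ ∞`:
`u_t = u_xx/((u_x)² + 1) − (n−1)/u + (1/ε) f(x) √((u_x)² + 1)`, `u(x,0) = ε^α g(x)`. -/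
structure IsSol (n : ℕ) (f g : ℝ → ℝ) (ε α : ℝ) (T : EReal) (u : ℝ → ℝ → ℝ) : Prop where
  pos : ∀ x t : ℝ, 0 ≤ t → (t : EReal) < T → 0 < u x t
  cont : ContinuousOn (fun p : ℝ × ℝ => u p.1 p.2)
    {p : ℝ × ℝ | 0 ≤ p.2 ∧ (p.2 : EReal) < T}
  smooth : ContDiffOn ℝ (⊤ : ℕ∞) (fun p : ℝ × ℝ => u p.1 p.2)
    {p : ℝ × ℝ | 0 < p.2 ∧ (p.2 : EReal) < T}
  periodic : ∀ x t : ℝ, u (x + 1) t = u x t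
  eqn : ∀ x t : ℝ, 0 < t → (t : EReal) < T →
    pdt u x t = pdxx u x t / ((pdx u x t) ^ 2 + 1) - ((n : ℝ) - 1) / u x t
      + (1 / ε) * f x * Real.sqrt ((pdx u x t) ^ 2 + 1)
  init : ∀ x : ℝ, u x 0 = ε ^ α * g x

lemma pdxx_eq_pdx_pdx (u : ℝ → ℝ → ℝ) (x t : ℝ) : pdxx u x t = pdx (pdx u) x t := rfl

lemma isOpen_timeStrip (T : EReal) : IsOpen {p : ℝ × ℝ | 0 < p.2 ∧ (p.2 : EReal) < T} :=
  (isOpen_lt continuous_const continuous_snd).inter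
    (isOpen_lt (continuous_coe_real_ereal.comp continuous_snd) continuous_const)

lemma hasDerivAt_pdx {u : ℝ → ℝ → ℝ} {x t : ℝ}
    (h : DifferentiableAt ℝ (fun p : ℝ × ℝ => u p.1 p.2) (x, t)) :
    HasDerivAt (fun y => u y t) (fderiv ℝ (fun p : ℝ × ℝ => u p.1 p.2) (x, t) (1, 0)) x :=
  h.hasFDerivAt.comp_hasDerivAt (f := fun y => (y, t)) x ((hasDerivAt_id x).prodMk (hasDerivAt_const x t))

lemma hasDerivAt_pdt {u : ℝ → ℝ → ℝ} {x t : ℝ}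
    (h : DifferentiableAt ℝ (fun p : ℝ × ℝ => u p.1 p.2) (x, t)) :
    HasDerivAt (fun s => u x s) (fderiv ℝ (fun p : ℝ × ℝ => u p.1 p.2) (x, t) (0, 1)) t :=
  h.hasFDerivAt.comp_hasDerivAt (f := fun s => (x, s)) t ((hasDerivAt_const t x).prodMk (hasDerivAt_id t))

section SmoothOnOpen

variable {u : ℝ → ℝ → ℝ} {S : Set (ℝ × ℝ)}

lemma differentiableAt_of_contDiffOn (hS : IsOpen S)
    (hu : ContDiffOn ℝ (⊤ : ℕ∞) (fun p : ℝ × ℝ => u p.1 p.2) S) {p : ℝ × ℝ} (hp : p ∈ S) :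
    DifferentiableAt ℝ (fun p : ℝ × ℝ => u p.1 p.2) p :=
  (hu.contDiffAt (hS.mem_nhds hp)).differentiableAt (by simp)

lemma contDiffOn_fderiv_apply (hS : IsOpen S)
    (hu : ContDiffOn ℝ (⊤ : ℕ∞) (fun p : ℝ × ℝ => u p.1 p.2) S) (w : ℝ × ℝ) :
    ContDiffOn ℝ (⊤ : ℕ∞) (fun p => fderiv ℝ (fun p : ℝ × ℝ => u p.1 p.2) p w) S :=
  (hu.fderiv_of_isOpen hS (by simp)).clm_apply contDiffOn_const

lemma contDiffOn_pdx (hS : IsOpen S)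
    (hu : ContDiffOn ℝ (⊤ : ℕ∞) (fun p : ℝ × ℝ => u p.1 p.2) S) :
    ContDiffOn ℝ (⊤ : ℕ∞) (fun p : ℝ × ℝ => pdx u p.1 p.2) S :=
  (contDiffOn_fderiv_apply hS hu (1, 0)).congr fun _ hp =>
    (hasDerivAt_pdx (differentiableAt_of_contDiffOn hS hu hp)).deriv

lemma contDiffOn_pdt (hS : IsOpen S)
    (hu : ContDiffOn ℝ (⊤ : ℕ∞) (fun p : ℝ × ℝ => u p.1 p.2) S) :
    ContDiffOn ℝ (⊤ : ℕ∞) (fun p : ℝ × ℝ => pdt u p.1 p.2) S :=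
  (contDiffOn_fderiv_apply hS hu (0, 1)).congr fun _ hp =>
    (hasDerivAt_pdt (differentiableAt_of_contDiffOn hS hu hp)).deriv

lemma hasDerivAt_pdx_of_mem (hS : IsOpen S)
    (hu : ContDiffOn ℝ (⊤ : ℕ∞) (fun p : ℝ × ℝ => u p.1 p.2) S) {x t : ℝ} (hp : (x, t) ∈ S) :
    HasDerivAt (fun y => u y t) (pdx u x t) x :=
  (hasDerivAt_pdx (differentiableAt_of_contDiffOn hS hu hp)).differentiableAt.hasDerivAt

/-- Mixed second partial derivatives of a smooth function commute. -/
lemma pdt_pdx_comm (hS : IsOpen S)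
    (hu : ContDiffOn ℝ (⊤ : ℕ∞) (fun p : ℝ × ℝ => u p.1 p.2) S) {x t : ℝ} (hp : (x, t) ∈ S) :
    pdt (pdx u) x t = pdx (pdt u) x t := by
  set F : ℝ × ℝ → ℝ := fun p => u p.1 p.2
  have hd : DifferentiableAt ℝ (fderiv ℝ F) (x, t) :=
    ((hu.fderiv_of_isOpen hS (m := (⊤ : ℕ∞)) (by simp)).contDiffAt
      (hS.mem_nhds hp)).differentiableAt (by simp)
  have hsymm : IsSymmSndFDerivAt ℝ F (x, t) :=
    (hu.contDiffAt (hS.mem_nhds hp)).isSymmSndFDerivAt (by simpa using WithTop.coe_le_coe.2 (le_top (a := (2 : ℕ∞))))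
  have h1 : (fun p : ℝ × ℝ => pdx u p.1 p.2) =ᶠ[𝓝 (x, t)] fun p => fderiv ℝ F p (1, 0) := by
    filter_upwards [hS.mem_nhds hp] with p hp
    exact (hasDerivAt_pdx (differentiableAt_of_contDiffOn hS hu hp)).deriv
  have h2 : (fun p : ℝ × ℝ => pdt u p.1 p.2) =ᶠ[𝓝 (x, t)] fun p => fderiv ℝ F p (0, 1) := by
    filter_upwards [hS.mem_nhds hp] with p hp
    exact (hasDerivAt_pdt (differentiableAt_of_contDiffOn hS hu hp)).deriv
  have e1 : pdt (pdx u) x t = _ := (hasDerivAt_pdt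
    (differentiableAt_of_contDiffOn hS (contDiffOn_pdx hS hu) hp)).deriv
  have e2 : pdx (pdt u) x t = _ := (hasDerivAt_pdx
    (differentiableAt_of_contDiffOn hS (contDiffOn_pdt hS hu) hp)).deriv
  rw [e1, e2, h1.fderiv_eq, h2.fderiv_eq,
    fderiv_clm_apply hd (differentiableAt_const _), fderiv_clm_apply hd (differentiableAt_const _)]
  simpa using hsymm (0, 1) (1, 0)

end SmoothOnOpen

/-- under (A1) with `f' ≥ 0` on `[0,1/2]`, if `u` is a positive classical
solution (equation with `ε = 1`) on `ℝ × [0,T)` and `u_x ≥ 0` on `(0,1/2) × (0,T)`, then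
`v := u_x` satisfies
`v_t ≥ v_xx/((u_x)²+1) + f(x) v v_x/√((u_x)²+1) − 2v(v_x)²/((u_x)²+1)²` there. -/
theorem differentiated_inequality (n : ℕ) (hn : 2 ≤ n) (f g : ℝ → ℝ) (hA1 : A1 f g)
    (hf' : ∀ x ∈ Set.Icc (0 : ℝ) (1 / 2), 0 ≤ deriv f x)
    (T : EReal) (hT : 0 < T) (u : ℝ → ℝ → ℝ) (hu : IsSol n f g 1 1 T u)
    (hux : ∀ x t : ℝ, 0 < x → x < 1 / 2 → 0 < t → (t : EReal) < T → 0 ≤ pdx u x t) :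
    ∀ v : ℝ → ℝ → ℝ, (∀ x t : ℝ, v x t = pdx u x t) →
      ∀ x t : ℝ, 0 < x → x < 1 / 2 → 0 < t → (t : EReal) < T →
        pdxx v x t / ((pdx u x t) ^ 2 + 1)
          + f x * v x t * pdx v x t / Real.sqrt ((pdx u x t) ^ 2 + 1)
          - 2 * v x t * (pdx v x t) ^ 2 / ((pdx u x t) ^ 2 + 1) ^ 2
        ≤ pdt v x t := by
  intro v hv x t hx hx2 ht htT
  obtain rfl : v = pdx u := funext₂ hv
  obtain ⟨hf, -⟩ := hA1
  have hS := isOpen_timeStrip T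
  have hsm := hu.smooth
  have hp : (x, t) ∈ {p : ℝ × ℝ | 0 < p.2 ∧ (p.2 : EReal) < T} := ⟨ht, htT⟩
  have hsm1 := contDiffOn_pdx hS hsm
  have hsm2 := contDiffOn_pdx hS hsm1
  have d0 := hasDerivAt_pdx_of_mem hS hsm hp
  have d1 := hasDerivAt_pdx_of_mem hS hsm1 hp
  have d2 := hasDerivAt_pdx_of_mem hS hsm2 hp
  have df := (hf.differentiable (by simp) x).hasDerivAt
  have hu0 := hu.pos x t ht.le htT
  have hw : 0 < (pdx u x t) ^ 2 + 1 := by positivity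
  have d1sq := (d1.pow 2).add_const (1 : ℝ)
  have dmain := ((d2.div d1sq hw.ne').sub
    ((hasDerivAt_const x ((n : ℝ) - 1)).div d0 hu0.ne')).add
    (df.mul (d1sq.sqrt hw.ne'))
  have heq : (fun y => pdt u y t) = _ := funext fun y => hu.eqn y t ht htT
  have key : pdt (pdx u) x t = _ := (pdt_pdx_comm hS hsm hp).trans
    ((congrArg (fun h : ℝ → ℝ => deriv h x) heq).trans
      ((dmain.congr_of_eventuallyEq (Eventually.of_forall fun y => by
        simp [pdxx_eq_pdx_pdx])).deriv))
  have hs : 0 < √((pdx u x t) ^ 2 + 1) := Real.sqrt_pos.2 hw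
  have hn1 : (0 : ℝ) ≤ (n : ℝ) - 1 := by
    have : (2 : ℝ) ≤ n := by exact_mod_cast hn
    linarith
  have a1 : 0 ≤ ((n : ℝ) - 1) * pdx u x t / u x t ^ 2 :=
    div_nonneg (mul_nonneg hn1 (hux x t hx hx2 ht htT)) (by positivity)
  have a2 : 0 ≤ deriv f x * √((pdx u x t) ^ 2 + 1) :=
    mul_nonneg (hf' x ⟨hx.le, hx2.le⟩) hs.le
  rw [key]
  refine le_of_sub_nonneg ((add_nonneg a1 a2).trans_eq ?_)
  simp only [pdxx_eq_pdx_pdx, Pi.pow_apply]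
  field_simp
  ring
end
end
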